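/- arXiv:1710.07343 — 5 statements merged into one kernel-verified Lean document; each statement's English description precedes it below -/
import Mathlib

section
/- Let (J,a) be a partial block matrix over a field 𝔽 with prescribed blocks A_{ij} ∈ 𝔽^{ν_i×μ_j} exactly for the positions 1 ≤ j ≤ i ≤ n (block lower triangular pattern of knowns, all other blocks unspecified). Then mr(J,a) = Σ_{i=1}^{n} rank (A_{kl})_{i ≤ k ≤ n, 1 ≤ l ≤ i} − Σ_{i=1}^{n−1} rank (A_{kl})_{i+1 ≤ k ≤ n, 1 ≤ l ≤ i}, where (A_{kl})_{...} denotes the matrix assembled from the indicated prescribed blocks. -/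
open Matrix

variable {F : Type*} [Field F] {m n : Type*} [Fintype m] [Fintype n]

/-- `B` is a completion of the partial matrix `(J, a)`: it agrees with the
prescribed entries on the pattern `J`. -/
def Completes (J : Set (m × n)) (a : m → n → F) (B : Matrix m n F) : Prop :=
  ∀ p ∈ J, B p.1 p.2 = a p.1 p.2

/-- Minimal rank of the partial matrix `(J, a)`: the minimum of the ranks of
all completions. -/
noncomputable def pmr (J : Set (m × n)) (a : m → n → F) : ℕ :=
  sInf {r : ℕ | ∃ B : Matrix m n F, Completes J a B ∧ B.rank = r}

/-- A pattern `T` is triangular if whenever `(i,j) ∈ T` and `(k,l) ∈ T`,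
then `(i,l) ∈ T` or `(k,j) ∈ T`. -/
def Triangular (T : Set (m × n)) : Prop :=
  ∀ p ∈ T, ∀ q ∈ T, (p.1, q.2) ∈ T ∨ (q.1, p.2) ∈ T

/-- Triangular minimal rank: the maximum of `pmr` over triangular
subpatterns of `J`. -/
noncomputable def ptmr (J : Set (m × n)) (a : m → n → F) : ℕ :=
  sSup {r : ℕ | ∃ T ⊆ J, Triangular T ∧ pmr T a = r}

/-- Pattern of the tensor `(J,a) ⊗ I_b`. -/
def TensorJ (J : Set (m × n)) (b : ℕ) : Set ((m × Fin b) × (n × Fin b)) :=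
  {p | (p.1.1, p.2.1) ∈ J}

/-- Entries of the tensor `(J,a) ⊗ I_b`: `a i j` on the diagonal of each
`b × b` block, `0` off the diagonal. -/
def TensorA (a : m → n → F) (b : ℕ) : m × Fin b → n × Fin b → F :=
  fun ip jq => if ip.2 = jq.2 then a ip.1 jq.1 else 0

/-- `b`-fold minimal rank `mr_b(J,a) = mr((J,a) ⊗ I_b)`. -/
noncomputable def pmrb (J : Set (m × n)) (a : m → n → F) (b : ℕ) : ℕ :=
  pmr (TensorJ J b) (TensorA a b)

/-- Fractional minimal rank: `inf_{b ≥ 1} mr_b(J,a) / b`. -/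
noncomputable def pfmr (J : Set (m × n)) (a : m → n → F) : ℝ :=
  ⨅ b : ℕ+, (pmrb J a b : ℝ) / (b : ℝ)

/-- Enlarging a subspace increases its dimension at least as much as it increases the dimension
of its image under a linear map. -/
theorem finrank_map_add_finrank_le {E E' : Type*} [AddCommGroup E] [Module F E]
    [FiniteDimensional F E] [AddCommGroup E'] [Module F E'] (π : E →ₗ[F] E')
    {V W : Submodule F E} (h : V ≤ W) :
    Module.finrank F (W.map π) + Module.finrank F V ≤
      Module.finrank F W + Module.finrank F (V.map π) := by
  have key (U : Submodule F E) : Module.finrank F (U.map π) +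
      Module.finrank F (U ⊓ LinearMap.ker π : Submodule F E) = Module.finrank F U := by
    have := LinearMap.finrank_range_add_finrank_ker (π.domRestrict U)
    rw [LinearMap.range_domRestrict, LinearMap.ker_domRestrict] at this
    rw [← this, ← Submodule.map_comap_subtype, Submodule.finrank_map_subtype_eq]
  have := Submodule.finrank_mono (inf_le_inf_right (LinearMap.ker π) h)
  have := key V
  have := key W
  omega

/-- Vectors in the codomain of a surjection can be lifted so that adjoining the lifts to a subspace
raises its dimension no more than it raises the dimension of the image. -/
theorem exists_lift_finrank_le {E E' ι : Type*} [AddCommGroup E] [Module F E]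
    [FiniteDimensional F E] [AddCommGroup E'] [Module F E'] (π : E →ₗ[F] E')
    (hπ : Function.Surjective π) (V : Submodule F E) (w : ι → E') :
    ∃ v : ι → E, (∀ j, π (v j) = w j) ∧ ∀ s : Set ι,
      Module.finrank F (V ⊔ Submodule.span F (v '' s) : Submodule F E) +
        Module.finrank F (V.map π) ≤
      Module.finrank F V +
        Module.finrank F ((V ⊔ Submodule.span F (v '' s)).map π) := by
  have : FiniteDimensional F E' := Module.Finite.of_surjective π hπ
  obtain ⟨σ, hσ⟩ := π.exists_rightInverse_of_surjective (LinearMap.range_eq_top.2 hπ)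
  have hσ' (x : E') : π (σ x) = x := LinearMap.congr_fun hσ x
  obtain ⟨Q, hQ⟩ := (V.map π).exists_isCompl
  have hw (j : ι) : ∃ x ∈ V, ∃ q ∈ Q, π x + q = w j := by
    have : w j ∈ V.map π ⊔ Q := hQ.sup_eq_top ▸ Submodule.mem_top
    obtain ⟨_, ⟨x, hx, rfl⟩, q, hq, h⟩ := Submodule.mem_sup.1 this
    exact ⟨x, hx, q, hq, h⟩
  choose x hx q hq h using hw
  refine ⟨fun j => x j + σ (q j), fun j => by rw [map_add, hσ', h], fun s => ?_⟩
  set v : ι → E := fun j => x j + σ (q j)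
  have hle : V ⊔ Submodule.span F (v '' s) ≤ V ⊔ (Submodule.span F (q '' s)).map σ := by
    refine sup_le le_sup_left (Submodule.span_le.2 ?_)
    rintro _ ⟨j, hj, rfl⟩
    exact Submodule.add_mem_sup (hx j)
      (Submodule.mem_map_of_mem (Submodule.subset_span ⟨j, hj, rfl⟩))
  have hge : V.map π ⊔ Submodule.span F (q '' s) ≤ (V ⊔ Submodule.span F (v '' s)).map π := by
    refine sup_le (Submodule.map_mono le_sup_left) (Submodule.span_le.2 ?_)
    rintro _ ⟨j, hj, rfl⟩
    refine ⟨v j - x j, sub_mem (Submodule.mem_sup_right (Submodule.subset_span ⟨j, hj, rfl⟩))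
      (Submodule.mem_sup_left (hx j)), ?_⟩
    simp [v, hσ']
  have hdisj : Disjoint (V.map π) (Submodule.span F (q '' s)) :=
    hQ.disjoint.mono_right (Submodule.span_le.2 (Set.image_subset_iff.2 fun j _ => hq j))
  have := Submodule.finrank_mono hle
  have := Submodule.finrank_add_le_finrank_add_finrank V ((Submodule.span F (q '' s)).map σ)
  have := Submodule.finrank_map_le σ (Submodule.span F (q '' s))
  have := Submodule.finrank_mono hge
  have := Submodule.finrank_sup_add_finrank_inf_eq (V.map π) (Submodule.span F (q '' s))
  rw [hdisj.eq_bot, finrank_bot] at this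
  omega

/-- The rank of a submatrix as the dimension of a projection of the span of rows of any matrix
agreeing with it. -/
theorem rank_submatrix_eq_finrank_map {R C : Type*} [Finite R] (a : R → C → F)
    (B : Matrix R C F) (p : R → Prop) (q : C → Prop) [Fintype {c // q c}]
    (h : ∀ r c, p r → q c → B r c = a r c) :
    (Matrix.of fun (r : {r // p r}) (c : {c // q c}) => a r.1 c.1).rank =
      Module.finrank F ((Submodule.span F (B.row '' {r | p r})).map
        (LinearMap.funLeft F F (Subtype.val : {c // q c} → C))) := by
  rw [Matrix.rank_eq_finrank_span_row, Submodule.map_span, ← Set.image_comp, Set.image_eq_range]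
  have : (Matrix.of fun (r : {r // p r}) (c : {c // q c}) => a r.1 c.1).row = fun r : {r | p r} =>
      (LinearMap.funLeft F F (Subtype.val : {c // q c} → C) ∘ B.row) r :=
    funext fun r => funext fun c => (h r.1 c.1 r.2 c.2).symm
  rw [this]

/-- The span of the rows of `B` of level at least `k`. -/
def rowSpan {N : ℕ} (f : m → Fin N) (B : Matrix m n F) (k : ℕ) : Submodule F (n → F) :=
  Submodule.span F (B.row '' {r | k ≤ f r})

theorem rank_of_completes_of_le {N : ℕ} {f : m → Fin N} {g : n → Fin N} {a : m → n → F}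
    {B : Matrix m n F} (hB : Completes {p : m × n | g p.2 ≤ f p.1} a B) (i : Fin N) :
    (Matrix.of fun (r : {r // i ≤ f r}) (c : {c // g c ≤ i}) => a r.1 c.1).rank =
      Module.finrank F ((rowSpan f B i).map
        (LinearMap.funLeft F F (Subtype.val : {c // g c ≤ i} → n))) :=
  rank_submatrix_eq_finrank_map a B _ _ fun r c hr hc => hB (r, c) (hc.trans hr)

theorem rank_of_completes_of_lt {N : ℕ} {f : m → Fin N} {g : n → Fin N} {a : m → n → F}
    {B : Matrix m n F} (hB : Completes {p : m × n | g p.2 ≤ f p.1} a B) (i : Fin N) :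
    (Matrix.of fun (r : {r // i < f r}) (c : {c // g c ≤ i}) => a r.1 c.1).rank =
      Module.finrank F ((rowSpan f B (i + 1)).map
        (LinearMap.funLeft F F (Subtype.val : {c // g c ≤ i} → n))) :=
  rank_submatrix_eq_finrank_map a B _ _ fun r c hr hc => hB (r, c) (hc.trans hr.le)

theorem rank_eq_sum_finrank_rowSpan {N : ℕ} (f : m → Fin N) (B : Matrix m n F) :
    (B.rank : ℤ) = ∑ i : Fin N, ((Module.finrank F (rowSpan f B i) : ℤ) -
      Module.finrank F (rowSpan f B (i + 1))) := by
  have h0 : Module.finrank F (rowSpan f B 0) = B.rank := by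
    have : {r | 0 ≤ (f r : ℕ)} = Set.univ := Set.eq_univ_of_forall fun r => Nat.zero_le _
    rw [rowSpan, Matrix.rank_eq_finrank_span_row, this, Set.image_univ]
  have hN : rowSpan f B N = ⊥ := by
    have : {r | N ≤ (f r : ℕ)} = ∅ := Set.eq_empty_of_forall_notMem fun r => (f r).2.not_ge
    rw [rowSpan, this, Set.image_empty, Submodule.span_empty]
  rw [Fin.sum_univ_eq_sum_range (fun i => (Module.finrank F (rowSpan f B i) : ℤ) -
    Module.finrank F (rowSpan f B (i + 1))), Finset.sum_range_sub', h0, hN]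
  simp

/-- Some completion has, at each level, row spans growing no faster than forced by the prescribed
entries. -/
theorem exists_completes_finrank_rowSpan_le {N : ℕ} (f : m → Fin N) (g : n → Fin N)
    (a : m → n → F) :
    ∃ B : Matrix m n F, Completes {p : m × n | g p.2 ≤ f p.1} a B ∧ ∀ i : Fin N,
      Module.finrank F (rowSpan f B i) +
        (Matrix.of fun (r : {r // i < f r}) (c : {c // g c ≤ i}) => a r.1 c.1).rank ≤
      Module.finrank F (rowSpan f B (i + 1)) +
        (Matrix.of fun (r : {r // i ≤ f r}) (c : {c // g c ≤ i}) => a r.1 c.1).rank := by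
  suffices H : ∃ B : Matrix m n F, Completes {p : m × n | g p.2 ≤ f p.1} a B ∧
      ∀ i : Fin N, 0 ≤ (i : ℕ) → Module.finrank F (rowSpan f B i) +
        (Matrix.of fun (r : {r // i < f r}) (c : {c // g c ≤ i}) => a r.1 c.1).rank ≤
      Module.finrank F (rowSpan f B (i + 1)) +
        (Matrix.of fun (r : {r // i ≤ f r}) (c : {c // g c ≤ i}) => a r.1 c.1).rank by
    simpa using H
  refine Nat.decreasingInduction' (m := 0) (n := N) (fun k hk _ ih => ?_) N.zero_le
    ⟨a, fun _ _ => rfl, fun i hi => absurd i.2 hi.not_gt⟩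
  obtain ⟨B, hB, hBr⟩ := ih
  let i₀ : Fin N := ⟨k, hk⟩
  obtain ⟨v, hv, hvr⟩ := exists_lift_finrank_le
    (LinearMap.funLeft F F (Subtype.val : {c // g c ≤ i₀} → n))
    (LinearMap.funLeft_surjective_of_injective F F _ Subtype.val_injective)
    (rowSpan f B (k + 1)) fun (r : m) c => a r c
  let B' : Matrix m n F := fun r => if f r = i₀ then v r else B r
  have hB' : Completes {p : m × n | g p.2 ≤ f p.1} a B' := by
    rintro ⟨r, c⟩ (hrc : g c ≤ f r)
    by_cases h : f r = i₀
    · simpa [B', h] using congrFun (hv r) ⟨c, h ▸ hrc⟩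
    · simpa [B', h] using hB (r, c) hrc
  have hlt (j : ℕ) (hj : k < j) : rowSpan f B' j = rowSpan f B j := by
    have : B'.row '' {r | j ≤ (f r : ℕ)} = B.row '' {r | j ≤ (f r : ℕ)} := by
      refine Set.image_congr fun r (hr : j ≤ (f r : ℕ)) => if_neg fun h => ?_
      exact hj.not_ge (hr.trans_eq (congrArg Fin.val h))
    rw [rowSpan, rowSpan, this]
  have heq : rowSpan f B' k = rowSpan f B (k + 1) ⊔ Submodule.span F (v '' {r | f r = i₀}) := by
    rw [← hlt _ k.lt_succ_self, rowSpan, rowSpan, ← Submodule.span_union]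
    have : v '' {r | f r = i₀} = B'.row '' {r | f r = i₀} :=
      Set.image_congr fun r hr => (if_pos hr).symm
    rw [this, ← Set.image_union]
    congr 2
    ext r
    simp only [Set.mem_ofPred_eq, Set.mem_union, Fin.ext_iff, i₀]
    omega
  refine ⟨B', hB', fun i hi => ?_⟩
  obtain hi | hi := hi.eq_or_lt
  · obtain rfl : i = i₀ := Fin.ext hi.symm
    rw [rank_of_completes_of_le hB', rank_of_completes_of_lt hB', heq, hlt _ k.lt_succ_self]
    exact hvr _
  · rw [hlt _ hi, hlt _ (hi.trans i.1.lt_succ_self)]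
    exact hBr i hi

/-- The minimal rank formula for rows and columns graded by arbitrary maps `f` and `g`, the entry
`(r, c)` being prescribed when `g c ≤ f r`. -/
theorem pmr_eq_sum_rank_sub_sum_rank {N : ℕ} (f : m → Fin N) (g : n → Fin N) (a : m → n → F) :
    (pmr {p : m × n | g p.2 ≤ f p.1} a : ℤ) =
      (∑ i : Fin N, ((Matrix.of fun (r : {r // i ≤ f r}) (c : {c // g c ≤ i}) =>
        a r.1 c.1).rank : ℤ)) -
      ∑ i : Fin N, ((Matrix.of fun (r : {r // i < f r}) (c : {c // g c ≤ i}) =>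
        a r.1 c.1).rank : ℤ) := by
  rw [← Finset.sum_sub_distrib]
  apply le_antisymm
  · obtain ⟨B, hB, hBr⟩ := exists_completes_finrank_rowSpan_le f g a
    have h : pmr {p : m × n | g p.2 ≤ f p.1} a ≤ B.rank := Nat.sInf_le ⟨B, hB, rfl⟩
    refine (Int.ofNat_le.2 h).trans ?_
    rw [rank_eq_sum_finrank_rowSpan f B]
    refine Finset.sum_le_sum fun i _ => ?_
    have := hBr i
    omega
  · obtain ⟨B, hB, hBr⟩ := Nat.sInf_mem (s := {r : ℕ | ∃ B : Matrix m n F,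
      Completes {p : m × n | g p.2 ≤ f p.1} a B ∧ B.rank = r}) ⟨_, a, fun _ _ => rfl, rfl⟩
    rw [pmr, ← hBr, rank_eq_sum_finrank_rowSpan f B]
    refine Finset.sum_le_sum fun i _ => ?_
    have := finrank_map_add_finrank_le
      (LinearMap.funLeft F F (Subtype.val : {c // g c ≤ i} → n))
      (show rowSpan f B (i + 1) ≤ rowSpan f B i from
        Submodule.span_mono (Set.image_mono fun r (hr : i + 1 ≤ (f r : ℕ)) =>
          (Nat.le_succ _).trans hr))
    rw [rank_of_completes_of_le hB, rank_of_completes_of_lt hB]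
    omega

/-- Minimal rank formula for a block lower triangular partial
matrix: rows are grouped as `Σ i : Fin N, Fin (ν i)`, columns as
`Σ j : Fin N, Fin (μ j)`, and the block `(i,j)` is prescribed exactly when
`j ≤ i`.  Then
`mr = Σ_i rank (A_{kl})_{k ≥ i, l ≤ i} − Σ_i rank (A_{kl})_{k > i, l ≤ i}`
(the second sum effectively runs over `i = 1, …, N−1` since the term at
`i = N` vanishes). -/
theorem stmt0 {F : Type*} [Field F] (N : ℕ) (ν μ : Fin N → ℕ)
    (a : (Σ i : Fin N, Fin (ν i)) → (Σ j : Fin N, Fin (μ j)) → F) :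
    (pmr {p : (Σ i : Fin N, Fin (ν i)) × (Σ j : Fin N, Fin (μ j)) | p.2.1 ≤ p.1.1} a : ℤ) =
      (∑ i : Fin N,
        ((Matrix.of fun (r : {r : Σ i' : Fin N, Fin (ν i') // i ≤ r.1})
            (c : {c : Σ j' : Fin N, Fin (μ j') // c.1 ≤ i}) => a r.1 c.1).rank : ℤ))
      - ∑ i : Fin N,
        ((Matrix.of fun (r : {r : Σ i' : Fin N, Fin (ν i') // i < r.1})
            (c : {c : Σ j' : Fin N, Fin (μ j') // c.1 ≤ i}) => a r.1 c.1).rank : ℤ) := by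
  exact pmr_eq_sum_rank_sub_sum_rank Sigma.fst Sigma.fst a
end

section
/- Let (J_A,a) be a partial m₁×n₁ matrix and (J_B,b) a partial m₂×n₂ matrix over a field 𝔽. Their direct sum (J_A,a) ⊕ (J_B,b) is the partial (m₁+m₂)×(n₁+n₂) matrix with pattern {(i,j) : (i,j) ∈ J_A} ∪ {(m₁+i, n₁+j) : (i,j) ∈ J_B} and the corresponding entries (all other positions unspecified). Then mr((J_A,a) ⊕ (J_B,b)) = max{mr(J_A,a), mr(J_B,b)}. -/
open Matrix

variable {F : Type*} [Field F] {m n : Type*} [Fintype m] [Fintype n]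

/-- Pattern of the direct sum of two partial matrices. -/
def DirectSumJ {m₁ n₁ m₂ n₂ : Type*} (JA : Set (m₁ × n₁)) (JB : Set (m₂ × n₂)) :
    Set ((m₁ ⊕ m₂) × (n₁ ⊕ n₂)) :=
  {p | (∃ i j, p = (Sum.inl i, Sum.inl j) ∧ (i, j) ∈ JA) ∨
       (∃ i j, p = (Sum.inr i, Sum.inr j) ∧ (i, j) ∈ JB)}

/-- Entries of the direct sum of two partial matrices (values off the two
diagonal blocks are irrelevant; we use `0`). -/
def DirectSumA {F : Type*} [Field F] {m₁ n₁ m₂ n₂ : Type*}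
    (a : m₁ → n₁ → F) (b : m₂ → n₂ → F) : (m₁ ⊕ m₂) → (n₁ ⊕ n₂) → F :=
  fun r c =>
    match r, c with
    | Sum.inl i, Sum.inl j => a i j
    | Sum.inr i, Sum.inr j => b i j
    | _, _ => 0

/-- A matrix of rank at most `k` factors through `Fin k`. -/
theorem exists_eq_mul_of_rank_le {m n : Type*} [Finite m] [Fintype n]
    (A : Matrix m n F) {k : ℕ} (h : A.rank ≤ k) :
    ∃ (L : Matrix m (Fin k) F) (R : Matrix (Fin k) n F), A = L * R := by
  classical
  let V := LinearMap.range A.mulVecLin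
  obtain ⟨f, hf⟩ : ∃ f : V →ₗ[F] (Fin k → F), Function.Injective f :=
    finrank_le_iff_exists_linearMap.1 ((Module.finrank_fin_fun F (n := k)).symm ▸ h)
  obtain ⟨g, hg⟩ := f.exists_leftInverse_of_injective (LinearMap.ker_eq_bot.2 hf)
  refine ⟨(V.subtype ∘ₗ g).toMatrix', (f ∘ₗ A.mulVecLin.rangeRestrict).toMatrix', ?_⟩
  rw [← LinearMap.toMatrix'_comp, LinearMap.comp_assoc, ← LinearMap.comp_assoc _ f g, hg,
    LinearMap.id_comp, LinearMap.subtype_comp_codRestrict]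
  exact (LinearMap.toMatrix'_toLin' A).symm

theorem pmr_le_rank {m n : Type*} [Fintype n]
    {J : Set (m × n)} {a : m → n → F} {B : Matrix m n F}
    (h : Completes J a B) : pmr J a ≤ B.rank :=
  Nat.sInf_le ⟨B, h, rfl⟩

theorem exists_completes_rank_eq_pmr {m n : Type*} [Fintype n]
    (J : Set (m × n)) (a : m → n → F) :
    ∃ B : Matrix m n F, Completes J a B ∧ B.rank = pmr J a :=
  Nat.sInf_mem (s := {r | ∃ B : Matrix m n F, Completes J a B ∧ B.rank = r})
    ⟨_, Matrix.of a, fun _ _ => rfl, rfl⟩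

/-- `mr(A ⊕ B) = max{mr(A), mr(B)}`. -/
theorem stmt2 {F : Type*} [Field F] (m₁ n₁ m₂ n₂ : ℕ)
    (JA : Set (Fin m₁ × Fin n₁)) (JB : Set (Fin m₂ × Fin n₂))
    (a : Fin m₁ → Fin n₁ → F) (b : Fin m₂ → Fin n₂ → F) :
    pmr (DirectSumJ JA JB) (DirectSumA a b) = max (pmr JA a) (pmr JB b) := by
  apply le_antisymm
  · obtain ⟨A, hA, hrA⟩ := exists_completes_rank_eq_pmr JA a
    obtain ⟨B, hB, hrB⟩ := exists_completes_rank_eq_pmr JB b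
    set k := max (pmr JA a) (pmr JB b)
    obtain ⟨LA, RA, rfl⟩ := exists_eq_mul_of_rank_le A (k := k) (hrA.trans_le (le_max_left _ _))
    obtain ⟨LB, RB, rfl⟩ := exists_eq_mul_of_rank_le B (k := k) (hrB.trans_le (le_max_right _ _))
    have hC : Completes (DirectSumJ JA JB) (DirectSumA a b)
        (Matrix.fromRows LA LB * Matrix.fromCols RA RB) := by
      rw [Matrix.fromRows_mul_fromCols]
      rintro _ (⟨i, j, rfl, hij⟩ | ⟨i, j, rfl, hij⟩)
      · exact hA _ hij
      · exact hB _ hij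
    exact (pmr_le_rank hC).trans
      ((Matrix.rank_mul_le_left _ _).trans <|
        (Matrix.rank_le_card_width _).trans_eq (Fintype.card_fin k))
  · obtain ⟨C, hC, hrC⟩ :=
      exists_completes_rank_eq_pmr (DirectSumJ JA JB) (DirectSumA a b)
    rw [← hrC]
    have hA : Completes JA a (C.submatrix Sum.inl Sum.inl) :=
      fun p hp => hC (Sum.inl p.1, Sum.inl p.2) (Or.inl ⟨p.1, p.2, rfl, hp⟩)
    have hB : Completes JB b (C.submatrix Sum.inr Sum.inr) :=
      fun p hp => hC (Sum.inr p.1, Sum.inr p.2) (Or.inr ⟨p.1, p.2, rfl, hp⟩)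
    exact max_le ((pmr_le_rank hA).trans (C.rank_submatrix_le _ _))
      ((pmr_le_rank hB).trans (C.rank_submatrix_le _ _))
end

section
/- With the cycle block pattern of invertible k×k blocks A_{11},…,A_{nn}, A_{12},…,A_{n−1,n}, A_{n1} over a field 𝔽 (n ≥ 3), every completion A satisfies (n−1)·rank(A) ≥ nk − d, where H = A_{11}^{-1}A_{12}A_{22}^{-1}A_{23}A_{33}^{-1}⋯A_{n-1,n-1}^{-1}A_{n-1,n}A_{nn}^{-1}A_{n1} and d = dim_𝔽 ker(H − I_k). In particular, (n−1)·mr ≥ nk − d. -/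
open Matrix

/-- A completion of the cycle block pattern: an `(nk) × (nk)` matrix, viewed as
an `n × n` array of `k × k` blocks, whose `(i,i)` block is `D i` and whose
`(i, i+1 mod n)` block is `U i` (so `U (n-1)` is the block in position
`(n, 1)`), all remaining blocks being arbitrary. -/
def CycCompletes {F : Type*} [Field F] {n k : ℕ} [NeZero n]
    (D U : Fin n → Matrix (Fin k) (Fin k) F)
    (A : Matrix (Fin n × Fin k) (Fin n × Fin k) F) : Prop :=
  ∀ i : Fin n, (∀ p q, A (i, p) (i, q) = D i p q) ∧
    (∀ p q, A (i, p) (i + 1, q) = U i p q)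

/-- Minimal rank of the cycle block partial matrix: the minimum of the ranks
of all completions. -/
noncomputable def cycMr {F : Type*} [Field F] (n k : ℕ) [NeZero n]
    (D U : Fin n → Matrix (Fin k) (Fin k) F) : ℕ :=
  sInf {r : ℕ | ∃ A : Matrix (Fin n × Fin k) (Fin n × Fin k) F,
    CycCompletes D U A ∧ A.rank = r}

/-- The ordered product
`H = A₁₁⁻¹ A₁₂ A₂₂⁻¹ A₂₃ ⋯ A_{n-1,n-1}⁻¹ A_{n-1,n} A_{nn}⁻¹ A_{n1}`,
i.e. `(D 0)⁻¹ * U 0 * (D 1)⁻¹ * U 1 * ⋯ * (D (n-1))⁻¹ * U (n-1)`. -/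
noncomputable def cycH {F : Type*} [Field F] (n k : ℕ)
    (D U : Fin n → Matrix (Fin k) (Fin k) F) : Matrix (Fin k) (Fin k) F :=
  (List.ofFn fun i : Fin n => (D i)⁻¹ * U i).prod

/-- If the rows `e` of `A` contain an invertible square submatrix, then a product `A * B` vanishing
on these rows has rank at most `rank A` minus the number of rows. -/
theorem rank_mul_add_card_le {F ι κ μ : Type*} [Field F] [Fintype ι] [Fintype κ]
    [DecidableEq κ] [Fintype μ] (A : Matrix ι ι F) (B : Matrix ι μ F)
    (e f : κ → ι) (hA : IsUnit (A.submatrix e f))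
    (hB : (A * B).submatrix e id = 0) :
    (A * B).rank + Fintype.card κ ≤ A.rank := by
  classical
  let φ : LinearMap.range A.mulVecLin →ₗ[F] (κ → F) :=
    (LinearMap.funLeft F F e).domRestrict (LinearMap.range A.mulVecLin)
  have hφ : LinearMap.range φ = ⊤ := by
    rw [LinearMap.range_eq_top]
    intro y
    obtain ⟨x, hx⟩ := (Matrix.mulVec_surjective_iff_isUnit.mpr hA) y
    let S : Matrix ι κ F := (1 : Matrix ι ι F).submatrix id f
    refine ⟨⟨A *ᵥ (S *ᵥ x), ⟨S *ᵥ x, rfl⟩⟩, ?_⟩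
    have hS : A * S = A.submatrix id f := by
      simpa [S] using (Matrix.submatrix_mul A (1 : Matrix ι ι F) id id f
        Function.bijective_id).symm
    rw [← hx]
    change (A *ᵥ (S *ᵥ x)) ∘ e = _
    rw [Matrix.mulVec_mulVec, hS]
    rfl
  have hker := φ.finrank_range_add_finrank_ker
  rw [hφ, finrank_top, Module.finrank_fintype_fun_eq_card] at hker
  have hle : LinearMap.range (A * B).mulVecLin ≤
      (LinearMap.ker φ).map (LinearMap.range A.mulVecLin).subtype := by
    rintro _ ⟨x, rfl⟩
    refine ⟨⟨A *ᵥ (B *ᵥ x), ⟨B *ᵥ x, rfl⟩⟩, ?_, ?_⟩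
    · change (A *ᵥ (B *ᵥ x)) ∘ e = 0
      rw [Matrix.mulVec_mulVec]
      change (A * B).submatrix e id *ᵥ x = 0
      rw [hB, Matrix.zero_mulVec]
    · change A *ᵥ (B *ᵥ x) = (A * B) *ᵥ x
      rw [Matrix.mulVec_mulVec]
  have hfin := (Submodule.finrank_mono hle).trans (Submodule.finrank_map_le _ _)
  unfold Matrix.rank
  omega

/-- The rank of matrices is subadditive. -/
theorem rank_matrix_add_le {F ι κ : Type*} [Field F] [Fintype ι] [Fintype κ]
    (A B : Matrix ι κ F) : (A + B).rank ≤ A.rank + B.rank := by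
  unfold Matrix.rank
  rw [Matrix.mulVecLin_add]
  exact (Submodule.finrank_mono (LinearMap.range_add_le _ _)).trans
    (Submodule.finrank_add_le_finrank_add_finrank _ _)

/-- Telescoping rank bound for an ordered product of transition matrices. -/
theorem rank_sub_mul_prod_ofFn_le {F ι κ : Type*} [Field F] [Fintype ι] [Fintype κ]
    [DecidableEq κ] (c m : ℕ) (Y : ℕ → Matrix ι κ F) (G : ℕ → Matrix κ κ F)
    (h : ∀ i, (Y (i + 1) - Y i * G i).rank ≤ c) :
    (Y m - Y 0 * (List.ofFn fun i : Fin m => G i).prod).rank ≤ m * c := by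
  induction m generalizing Y G with
  | zero => simp
  | succ m ih =>
    have ih' := ih (fun i => Y (i + 1)) (fun i => G (i + 1)) fun i => h (i + 1)
    rw [List.ofFn_succ, List.prod_cons]
    simp only [Fin.val_zero, Fin.val_succ]
    set P := (List.ofFn fun i : Fin m => G (i + 1)).prod
    have key : Y (m + 1) - Y 0 * (G 0 * P) =
        (Y (m + 1) - Y (0 + 1) * P) + (Y (0 + 1) - Y 0 * G 0) * P := by
      rw [Matrix.sub_mul, Matrix.mul_assoc]
      abel
    rw [key]
    calc _ ≤ _ := rank_matrix_add_le _ _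
      _ ≤ m * c + c := add_le_add ih' ((Matrix.rank_mul_le_left _ _).trans (h 0))
      _ = (m + 1) * c := by ring

/-- A cycle pattern with at least two blocks has a completion. -/
theorem exists_cycCompletes {F : Type*} [Field F] {n k : ℕ} [NeZero n] (hn : 2 ≤ n)
    (D U : Fin n → Matrix (Fin k) (Fin k) F) : ∃ A, CycCompletes D U A := by
  refine ⟨fun x y => if y.1 = x.1 then D x.1 x.2 y.2 else U x.1 x.2 y.2, fun i => ?_⟩
  have : Nontrivial (Fin n) := Fin.nontrivial_iff_two_le.mpr hn
  have hi : i + 1 ≠ i := by simp; omega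
  simp [hi]

/-- The rank bound for a single completion. -/
theorem CycCompletes.rank_bound {F : Type*} [Field F] {n k : ℕ} [NeZero n]
    {D U : Fin n → Matrix (Fin k) (Fin k) F} (hD : ∀ i, IsUnit (D i))
    {A : Matrix (Fin n × Fin k) (Fin n × Fin k) F} (hA : CycCompletes D U A) :
    n * k - Module.finrank F
      (LinearMap.ker (Matrix.mulVecLin (cycH n k D U - 1))) ≤ (n - 1) * A.rank := by
  let Y : Fin n → Matrix (Fin n × Fin k) (Fin k) F := fun j => A.submatrix id (Prod.mk j)
  let g : Fin n → Matrix (Fin k) (Fin k) F := fun i => (D i)⁻¹ * U i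
  have hdiag (i : Fin n) : A.submatrix (Prod.mk i) (Prod.mk i) = D i := by
    ext p q
    exact (hA i).1 p q
  have hsup (i : Fin n) : A.submatrix (Prod.mk i) (Prod.mk (i + 1)) = U i := by
    ext p q
    exact (hA i).2 p q
  have hDg (i : Fin n) : D i * g i = U i :=
    Matrix.mul_nonsing_inv_cancel_left _ _ ((Matrix.isUnit_iff_isUnit_det _).mp (hD i))
  have hrow (i : Fin n) : (Y (i + 1) - Y i * g i).submatrix (Prod.mk i) id = 0 := by
    change A.submatrix (Prod.mk i) (Prod.mk (i + 1)) -
      A.submatrix (Prod.mk i) (Prod.mk i) * g i = 0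
    rw [hdiag, hsup, hDg, sub_self]
  have hrank (i : Fin n) : (Y (i + 1) - Y i * g i).rank + k ≤ A.rank := by
    let S : Fin n → Matrix (Fin n × Fin k) (Fin k) F := fun j =>
      (1 : Matrix (Fin n × Fin k) (Fin n × Fin k) F).submatrix id (Prod.mk j)
    have hS (j : Fin n) : A * S j = Y j := by
      simpa [S, Y] using (Matrix.submatrix_mul A
        (1 : Matrix (Fin n × Fin k) (Fin n × Fin k) F) id id (Prod.mk j)
        Function.bijective_id).symm
    have hM : A * (S (i + 1) - S i * g i) = Y (i + 1) - Y i * g i := by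
      rw [Matrix.mul_sub, ← Matrix.mul_assoc, hS, hS]
    have := rank_mul_add_card_le A (S (i + 1) - S i * g i) (Prod.mk i) (Prod.mk i)
      (by rw [hdiag]; exact hD i) (by rw [hM]; exact hrow i)
    rwa [hM, Fintype.card_fin] at this
  obtain ⟨m, rfl⟩ := Nat.exists_eq_succ_of_ne_zero (NeZero.ne n)
  have hsucc (i : ℕ) : Fin.ofNat (m + 1) (i + 1) = Fin.ofNat (m + 1) i + 1 := by
    ext
    simp [Fin.val_add]
  have htel := rank_sub_mul_prod_ofFn_le (A.rank - k) m
    (fun i => Y (Fin.ofNat (m + 1) (i + 1))) (fun i => g (Fin.ofNat (m + 1) (i + 1)))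
    (fun i => by
      have := hrank (Fin.ofNat (m + 1) (i + 1))
      rw [← hsucc] at this
      omega)
  set P := (List.ofFn fun i : Fin m => g (Fin.ofNat (m + 1) (i + 1))).prod with hP
  have hH : cycH (m + 1) k D U = g 0 * P := by
    rw [cycH, List.ofFn_succ, List.prod_cons, hP]
    congr 3
    funext i
    have : Fin.ofNat (m + 1) (i + 1) = i.succ := by
      ext
      simp
    rw [this]
  have hlast : Fin.ofNat (m + 1) (m + 1) = 0 := by
    ext
    simp
  have hfirst : Fin.ofNat (m + 1) (0 + 1) = 0 + 1 := by
    ext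
    simp
  simp only [hlast, hfirst] at htel
  have hYH : (Y 0 - Y (0 + 1) * P).submatrix (Prod.mk 0) id =
      -D 0 * (cycH (m + 1) k D U - 1) := by
    change A.submatrix (Prod.mk 0) (Prod.mk 0) -
      A.submatrix (Prod.mk 0) (Prod.mk (0 + 1)) * P = _
    rw [hdiag, hsup, hH, Matrix.neg_mul, Matrix.mul_sub, ← Matrix.mul_assoc, hDg, Matrix.mul_one, neg_sub]
  have hle : (cycH (m + 1) k D U - 1).rank ≤ m * (A.rank - k) := by
    have h1 := ((Y 0 - Y (0 + 1) * P).rank_submatrix_le (Prod.mk 0) id).trans htel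
    rwa [hYH, Matrix.rank_mul_eq_right_of_isUnit_det _ _
      ((Matrix.isUnit_iff_isUnit_det _).mp (hD 0).neg)] at h1
  have hnull := (Matrix.mulVecLin (cycH (m + 1) k D U - 1)).finrank_range_add_finrank_ker
  rw [Module.finrank_fintype_fun_eq_card, Fintype.card_fin] at hnull
  change (cycH (m + 1) k D U - 1).rank + _ = k at hnull
  have hk : k ≤ A.rank := le_of_add_le_right (hrank 0)
  have hmk : m * (A.rank - k) + m * k = m * A.rank := by
    rw [← mul_add, Nat.sub_add_cancel hk]
  have hexp : (m + 1) * k = m * k + k := by ring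
  simp only [Nat.succ_eq_add_one, Nat.add_sub_cancel]
  omega

/-- For the cycle block pattern of invertible `k × k` blocks,
every completion `A` satisfies `(n-1)·rank(A) ≥ nk − d`, where
`d = dim ker(H − I)`.  In particular `(n-1)·mr ≥ nk − d`. -/
theorem stmt13 {F : Type*} [Field F] (n k : ℕ) [NeZero n] (hn : 3 ≤ n) (hk : 1 ≤ k)
    (D U : Fin n → Matrix (Fin k) (Fin k) F)
    (hD : ∀ i, IsUnit (D i)) (hU : ∀ i, IsUnit (U i)) :
    (∀ A : Matrix (Fin n × Fin k) (Fin n × Fin k) F, CycCompletes D U A →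
        n * k - Module.finrank F
            (LinearMap.ker (Matrix.mulVecLin (cycH n k D U - 1))) ≤ (n - 1) * A.rank) ∧
      n * k - Module.finrank F
          (LinearMap.ker (Matrix.mulVecLin (cycH n k D U - 1))) ≤ (n - 1) * cycMr n k D U := by
  refine ⟨fun A hA => hA.rank_bound hD, ?_⟩
  obtain ⟨A, hA⟩ := exists_cycCompletes (by omega) D U
  obtain ⟨B, hB, hr⟩ := Nat.sInf_mem
    (s := {r : ℕ | ∃ A : Matrix (Fin n × Fin k) (Fin n × Fin k) F, CycCompletes D U A ∧ A.rank = r})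
    ⟨_, A, hA, rfl⟩
  rw [cycMr, ← hr]
  exact hB.rank_bound hD
end

section
/- With the cycle block pattern of invertible k×k blocks A_{11},…,A_{nn}, A_{12},…,A_{n−1,n}, A_{n1} over a field 𝔽 (n ≥ 3), if H = A_{11}^{-1}A_{12}A_{22}^{-1}A_{23}A_{33}^{-1}⋯A_{n-1,n-1}^{-1}A_{n-1,n}A_{nn}^{-1}A_{n1} equals the identity matrix I_k, then mr = k. -/
open Matrix

/-- Every completion has rank at least `k`, since it contains an invertible diagonal block. -/
theorem CycCompletes.le_rank {F : Type*} [Field F] {n k : ℕ} [NeZero n]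
    {D U : Fin n → Matrix (Fin k) (Fin k) F}
    {A : Matrix (Fin n × Fin k) (Fin n × Fin k) F}
    (hA : CycCompletes D U A) {i : Fin n} (hD : IsUnit (D i)) : k ≤ A.rank := by
  have hsub : A.submatrix (Prod.mk i) (Prod.mk i) = D i := by
    ext p q
    exact (hA i).1 p q
  calc k = (D i).rank := by rw [rank_of_isUnit _ hD, Fintype.card_fin]
    _ ≤ A.rank := hsub ▸ rank_submatrix_le A _ _

/-- A completion whose blocks factor as `X i * Y j` through dimension `k` has rank at most `k`. -/
theorem rank_of_block_mul_le {F ι : Type*} [Field F] [Fintype ι] {k : ℕ}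
    (X Y : ι → Matrix (Fin k) (Fin k) F) :
    (of fun a b : ι × Fin k => (X a.1 * Y b.1) a.2 b.2).rank ≤ k := by
  have h : (of fun a b : ι × Fin k => (X a.1 * Y b.1) a.2 b.2) =
      (of fun (a : ι × Fin k) (q : Fin k) => X a.1 a.2 q) *
        (of fun (q : Fin k) (b : ι × Fin k) => Y b.1 q b.2) := rfl
  rw [h]
  exact (rank_mul_le_left _ _).trans ((rank_le_card_width _).trans_eq (Fintype.card_fin k))

/-- If the cyclic product of the units `f i` is `1`, then the partial products `P i` are units
and satisfy `P (i + 1) = P i * f i` cyclically. -/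
theorem exists_cyclic_partial_prod {M : Type*} [Monoid M] {n : ℕ} [NeZero n] (f : Fin n → M)
    (hf : ∀ i, IsUnit (f i)) (h : (List.ofFn f).prod = 1) :
    ∃ P : Fin n → M, (∀ i, IsUnit (P i)) ∧ ∀ i, P (i + 1) = P i * f i := by
  have hsucc (i : Fin n) :
      ((List.ofFn f).take (i + 1)).prod = ((List.ofFn f).take i).prod * f i := by
    rw [List.prod_take_succ _ _ (by simp)]
    simp
  refine ⟨fun i => ((List.ofFn f).take i).prod, fun i => ?_, fun i => ?_⟩
  · refine List.prod_isUnit fun m hm => ?_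
    obtain ⟨j, rfl⟩ := List.mem_ofFn.mp (List.mem_of_mem_take hm)
    exact hf j
  · dsimp only
    rw [← hsucc]
    rcases (Nat.succ_le_of_lt i.isLt).lt_or_eq with hi | hi
    · rw [Fin.val_add_one_of_lt' hi]
    · have hval : ((i + 1 : Fin n) : ℕ) = 0 := by
        rw [Fin.val_add, Fin.val_one', Nat.add_mod_mod, ← Nat.succ_eq_add_one, hi, Nat.mod_self]
      rw [hval, List.take_zero, List.prod_nil, ← Nat.succ_eq_add_one, hi,
        List.take_of_length_le (by simp), h]

/-- If `H = I_k`, some completion has rank at most `k`. -/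
theorem exists_cycCompletes_rank_le {F : Type*} [Field F] {n k : ℕ} [NeZero n]
    {D U : Fin n → Matrix (Fin k) (Fin k) F}
    (hD : ∀ i, IsUnit (D i)) (hU : ∀ i, IsUnit (U i)) (hH : cycH n k D U = 1) :
    ∃ A, CycCompletes D U A ∧ A.rank ≤ k := by
  obtain ⟨P, hP, hsucc⟩ := exists_cyclic_partial_prod (fun i => (D i)⁻¹ * U i)
    (fun i => ((isUnit_nonsing_inv_iff).2 (hD i)).mul (hU i)) hH
  have hD' (i : Fin n) := (isUnit_iff_isUnit_det _).1 (hD i)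
  have hP' (i : Fin n) := (isUnit_iff_isUnit_det _).1 (hP i)
  refine ⟨of fun a b => (D a.1 * (P a.1)⁻¹ * P b.1) a.2 b.2, fun i => ⟨fun p q => ?_, fun p q => ?_⟩,
    rank_of_block_mul_le (fun i => D i * (P i)⁻¹) P⟩
  · simp only [of_apply]
    rw [nonsing_inv_mul_cancel_right _ _ (hP' i)]
  · simp only [of_apply]
    rw [hsucc, ← Matrix.mul_assoc, nonsing_inv_mul_cancel_right _ _ (hP' i),
      mul_nonsing_inv_cancel_left _ _ (hD' i)]

/-- For the cycle block pattern of invertible `k × k` blocks,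
if `H = I_k` then the minimal rank equals `k`. -/
theorem stmt14 {F : Type*} [Field F] (n k : ℕ) [NeZero n] (hn : 3 ≤ n) (hk : 1 ≤ k)
    (D U : Fin n → Matrix (Fin k) (Fin k) F)
    (hD : ∀ i, IsUnit (D i)) (hU : ∀ i, IsUnit (U i))
    (hH : cycH n k D U = 1) :
    cycMr n k D U = k := by
  obtain ⟨A, hA, hrank⟩ := exists_cycCompletes_rank_le hD hU hH
  refine IsLeast.csInf_eq ⟨⟨A, hA, hrank.antisymm (hA.le_rank (hD 0))⟩, ?_⟩
  rintro _ ⟨B, hB, rfl⟩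
  exact hB.le_rank (hD 0)
end

section
/- With the cycle block pattern of invertible k×k blocks A_{11},…,A_{nn}, A_{12},…,A_{n−1,n}, A_{n1} over a field 𝔽 (n ≥ 3), set H = A_{11}^{-1}A_{12}A_{22}^{-1}A_{23}A_{33}^{-1}⋯A_{n-1,n-1}^{-1}A_{n-1,n}A_{nn}^{-1}A_{n1}. Then the minimal rank of this partial block matrix equals the minimal rank of the cycle block pattern whose prescribed blocks are I_k at every position (i,i) (1 ≤ i ≤ n) and (i,i+1) (1 ≤ i ≤ n−1), and H at position (n,1). -/
open Matrix

/-- Multiplying the `(i, j)` block of `A` by `L i` on the left and by `R j` on the right. -/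
def blockScale {F : Type*} [Field F] {n k : ℕ} (L R : Fin n → Matrix (Fin k) (Fin k) F)
    (A : Matrix (Fin n × Fin k) (Fin n × Fin k) F) : Matrix (Fin n × Fin k) (Fin n × Fin k) F :=
  compRingEquiv (Fin n) (Fin k) F (diagonal L) * A * compRingEquiv (Fin n) (Fin k) F (diagonal R)

theorem blockScale_comp {F : Type*} [Field F] {n k : ℕ} (L R : Fin n → Matrix (Fin k) (Fin k) F)
    (B : Matrix (Fin n) (Fin n) (Matrix (Fin k) (Fin k) F)) :
    blockScale L R (compRingEquiv (Fin n) (Fin k) F B) =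
      compRingEquiv (Fin n) (Fin k) F (of fun i j => L i * B i j * R j) := by
  rw [blockScale, ← map_mul, ← map_mul]
  congr 1
  ext i j : 2
  rw [mul_diagonal, diagonal_mul, of_apply]

theorem rank_blockScale {F : Type*} [Field F] {n k : ℕ} {L R : Fin n → Matrix (Fin k) (Fin k) F}
    (hL : ∀ i, IsUnit (L i)) (hR : ∀ i, IsUnit (R i))
    (A : Matrix (Fin n × Fin k) (Fin n × Fin k) F) : (blockScale L R A).rank = A.rank := by
  have key : ∀ {S : Fin n → Matrix (Fin k) (Fin k) F}, (∀ i, IsUnit (S i)) →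
      IsUnit (compRingEquiv (Fin n) (Fin k) F (diagonal S)).det := fun hS =>
    (isUnit_iff_isUnit_det _).1
      (((Pi.isUnit_iff.2 hS).map (diagonalRingHom (Fin n) (Matrix (Fin k) (Fin k) F))).map
        (compRingEquiv (Fin n) (Fin k) F))
  rw [blockScale, rank_mul_eq_left_of_isUnit_det _ _ (key hR),
    rank_mul_eq_right_of_isUnit_det _ _ (key hL)]

theorem cycCompletes_comp_iff {F : Type*} [Field F] {n k : ℕ} [NeZero n]
    {D U : Fin n → Matrix (Fin k) (Fin k) F}
    {B : Matrix (Fin n) (Fin n) (Matrix (Fin k) (Fin k) F)} :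
    CycCompletes D U (compRingEquiv (Fin n) (Fin k) F B) ↔
      ∀ i, B i i = D i ∧ B i (i + 1) = U i := by
  simp only [CycCompletes, ← Matrix.ext_iff]
  rfl

theorem CycCompletes.blockScale {F : Type*} [Field F] {n k : ℕ} [NeZero n]
    {D U : Fin n → Matrix (Fin k) (Fin k) F} {A : Matrix (Fin n × Fin k) (Fin n × Fin k) F}
    (h : CycCompletes D U A) (L R : Fin n → Matrix (Fin k) (Fin k) F) :
    CycCompletes (fun i => L i * D i * R i) (fun i => L i * U i * R (i + 1))
      (blockScale L R A) := by
  obtain ⟨B, rfl⟩ := (compRingEquiv (Fin n) (Fin k) F).surjective A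
  rw [blockScale_comp]
  rw [cycCompletes_comp_iff] at h ⊢
  intro i
  simp [(h i).1, (h i).2]

/-- The minimal rank is invariant under invertible block row and block column scalings. -/
theorem cycMr_blockScale {F : Type*} [Field F] {n k : ℕ} [NeZero n]
    (D U : Fin n → Matrix (Fin k) (Fin k) F) {L R : Fin n → Matrix (Fin k) (Fin k) F}
    (hL : ∀ i, IsUnit (L i)) (hR : ∀ i, IsUnit (R i)) :
    cycMr n k (fun i => L i * D i * R i) (fun i => L i * U i * R (i + 1)) = cycMr n k D U := by
  have cancel : ∀ (i j : Fin n) (M : Matrix (Fin k) (Fin k) F),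
      (L i)⁻¹ * (L i * M * R j) * (R j)⁻¹ = M := fun i j M => by
    rw [Matrix.mul_assoc (L i), nonsing_inv_mul_cancel_left _ _ ((isUnit_iff_isUnit_det _).1 (hL i)),
      mul_nonsing_inv_cancel_right _ _ ((isUnit_iff_isUnit_det _).1 (hR j))]
  unfold cycMr
  congr 1
  ext r
  constructor
  · rintro ⟨A, hA, rfl⟩
    refine ⟨_, ?_, rank_blockScale (fun i => isUnit_nonsing_inv_iff.2 (hL i))
      (fun i => isUnit_nonsing_inv_iff.2 (hR i)) A⟩
    simpa only [cancel] using hA.blockScale (fun i => (L i)⁻¹) (fun i => (R i)⁻¹)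
  · rintro ⟨A, hA, rfl⟩
    exact ⟨_, hA.blockScale L R, rank_blockScale hL hR A⟩

/-- The minimal rank of the cycle block pattern with
invertible blocks `D i`, `U i` equals the minimal rank of the cycle block
pattern whose prescribed blocks are `I_k` at every position `(i,i)` and
`(i,i+1)` (`1 ≤ i ≤ n−1`), and `H` at position `(n,1)`. -/
theorem stmt16 {F : Type*} [Field F] (n k : ℕ) [NeZero n] (hn : 3 ≤ n) (hk : 1 ≤ k)
    (D U : Fin n → Matrix (Fin k) (Fin k) F)
    (hD : ∀ i, IsUnit (D i)) (hU : ∀ i, IsUnit (U i)) :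
    cycMr n k D U =
      cycMr n k (fun _ => (1 : Matrix (Fin k) (Fin k) F))
        (fun i => if (i : ℕ) = n - 1 then cycH n k D U else 1) := by
  let G : List (Matrix (Fin k) (Fin k) F) := List.ofFn fun i : Fin n => (D i)⁻¹ * U i
  let P : ℕ → Matrix (Fin k) (Fin k) F := fun m => (G.take m).prod
  have hP0 : P 0 = 1 := by simp [P]
  have hPn : P n = cycH n k D U := by
    simp only [P, cycH]
    rw [List.take_of_length_le (by simp [G])]
  have hPs : ∀ i : Fin n, P (i + 1) = P i * ((D i)⁻¹ * U i) := fun i => by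
    simp only [P]
    rw [List.prod_take_succ _ _ (by simp [G])]
    simp [G]
  have hPu : ∀ m, m ≤ n → IsUnit (P m) := by
    intro m
    induction m with
    | zero => exact fun _ => hP0 ▸ isUnit_one
    | succ m ih =>
      intro hm
      rw [hPs ⟨m, hm⟩]
      exact (ih (by omega)).mul ((isUnit_nonsing_inv_iff.2 (hD _)).mul (hU _))
  have hPd : ∀ m, m ≤ n → IsUnit (P m).det := fun m hm => (isUnit_iff_isUnit_det _).1 (hPu m hm)
  rw [← cycMr_blockScale D U (L := fun i => P i * (D i)⁻¹) (R := fun i => (P i)⁻¹)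
    (fun i => (hPu i i.2.le).mul (isUnit_nonsing_inv_iff.2 (hD i)))
    (fun i => isUnit_nonsing_inv_iff.2 (hPu i i.2.le))]
  congr 1
  · funext i
    rw [nonsing_inv_mul_cancel_right _ _ ((isUnit_iff_isUnit_det _).1 (hD i)),
      mul_nonsing_inv _ (hPd i i.2.le)]
  · funext i
    rw [Matrix.mul_assoc (P i), ← hPs]
    split_ifs with hi
    · have hlast : ((i + 1 : Fin n) : ℕ) = 0 := by
        rw [Fin.val_add, Fin.val_one', Nat.add_mod_mod, hi, Nat.sub_add_cancel (by omega),
          Nat.mod_self]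
      rw [hlast, hP0, inv_one, Matrix.mul_one, hi, Nat.sub_add_cancel (by omega), hPn]
    · have hlt : (i : ℕ) + 1 < n := by omega
      have hnext : ((i + 1 : Fin n) : ℕ) = i + 1 := by
        rw [Fin.val_add, Fin.val_one', Nat.add_mod_mod, Nat.mod_eq_of_lt hlt]
      rw [hnext, mul_nonsing_inv _ (hPd _ hlt.le)]
end
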